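/- Let d ≥ 1 and let A be an m×n row-stochastic real matrix that is ultraweakly maximal in C(Q_d): A has a quantum implementation in dimension d, and for every row-stochastic matrix B (of any finite size) with a quantum implementation in dimension d, A ⪯ B implies B ⪯ A. Then A is ultraweakly equivalent to the d×d identity matrix I_d, i.e., A ⪯ I_d and I_d ⪯ A. In other words, the equivalence class of I_d is the only maximal element among quantum communication matrices in dimension d. -/

import Mathlib

open Matrix BigOperators
open scoped ComplexOrder

/-- A real matrix is row-stochastic if all entries are nonnegative
and each row sums to 1. -/
def RowStochastic {m n : ℕ} (A : Matrix (Fin m) (Fin n) ℝ) : Prop :=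
  (∀ i j, 0 ≤ A i j) ∧ ∀ i, ∑ j, A i j = 1

/-- `A` admits a quantum implementation in dimension `d`: there are states
`ρ i` (PSD, trace one) and POVM effects `M j` (PSD, summing to the identity)
with `A i j = Re (tr (ρ i * M j))`. -/
def QuantumImpl (d m n : ℕ) (A : Matrix (Fin m) (Fin n) ℝ) : Prop :=
  ∃ (ρ : Fin m → Matrix (Fin d) (Fin d) ℂ) (M : Fin n → Matrix (Fin d) (Fin d) ℂ),
    (∀ i, (ρ i).PosSemidef ∧ (ρ i).trace = 1) ∧
    (∀ j, (M j).PosSemidef) ∧ (∑ j, M j = 1) ∧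
    (∀ i j, A i j = ((ρ i * M j).trace).re)

/-- The max monotone `λmax(A) = Σ_j max_i A i j`. -/
noncomputable def lmax {m n : ℕ} (A : Matrix (Fin m) (Fin n) ℝ) : ℝ :=
  ∑ j, ⨆ i, A i j

/-- The min monotone `λmin(A) = −Σ_j min_i A i j`. -/
noncomputable def lmin {m n : ℕ} (A : Matrix (Fin m) (Fin n) ℝ) : ℝ :=
  - ∑ j, ⨅ i, A i j

/-- `UWMaj B A` : `B` is ultraweakly majorized by `A` (i.e. `B ⪯ A`),
meaning `B = L * A * R` for some row-stochastic `L`, `R`. -/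
def UWMaj {m' n' m n : ℕ} (B : Matrix (Fin m') (Fin n') ℝ)
    (A : Matrix (Fin m) (Fin n) ℝ) : Prop :=
  ∃ (L : Matrix (Fin m') (Fin m) ℝ) (R : Matrix (Fin n) (Fin n') ℝ),
    RowStochastic L ∧ RowStochastic R ∧ L * A * R = B

/-- A density matrix: positive semidefinite of trace one. -/
def IsState {d : ℕ} (ρ : Matrix (Fin d) (Fin d) ℂ) : Prop :=
  ρ.PosSemidef ∧ ρ.trace = 1

/-- A pure state, i.e. a rank-one projection. -/
def IsPure {d : ℕ} (P : Matrix (Fin d) (Fin d) ℂ) : Prop :=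
  IsState P ∧ ∀ X, P * X * P = (P * X).trace • P

/-- The probability that the effect `Y` occurs in the state `X`. -/
noncomputable def born {d : ℕ} (X Y : Matrix (Fin d) (Fin d) ℂ) : ℝ :=
  ((X * Y).trace).re

section Born

variable {d : ℕ}

lemma born_comm (X Y : Matrix (Fin d) (Fin d) ℂ) : born X Y = born Y X := by
  rw [born, born, trace_mul_comm]

lemma born_sum_right {ι : Type*} (s : Finset ι) (X : Matrix (Fin d) (Fin d) ℂ)
    (Y : ι → Matrix (Fin d) (Fin d) ℂ) : born X (∑ i ∈ s, Y i) = ∑ i ∈ s, born X (Y i) := by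
  simp [born, Finset.mul_sum, trace_sum]

lemma born_smul_right (a : ℝ) (X Y : Matrix (Fin d) (Fin d) ℂ) :
    born X (a • Y) = a * born X Y := by
  simp [born]

lemma born_smul_left (a : ℝ) (X Y : Matrix (Fin d) (Fin d) ℂ) :
    born (a • X) Y = a * born X Y := by
  simp [born]

lemma born_add_left (X X' Y : Matrix (Fin d) (Fin d) ℂ) :
    born (X + X') Y = born X Y + born X' Y := by
  simp [born, add_mul]

lemma born_one_right {ρ : Matrix (Fin d) (Fin d) ℂ} (hρ : IsState ρ) : born ρ 1 = 1 := by
  simp [born, hρ.2]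

lemma exists_smul_isPure (hd : 1 ≤ d) (v : Fin d → ℂ) :
    ∃ (c : ℝ) (P : Matrix (Fin d) (Fin d) ℂ),
      0 ≤ c ∧ IsPure P ∧ vecMulVec v (star v) = c • P := by
  have key : ∀ w : Fin d → ℂ, w ≠ 0 → ∃ (c : ℝ) (P : Matrix (Fin d) (Fin d) ℂ),
      0 ≤ c ∧ IsPure P ∧ vecMulVec w (star w) = c • P := by
    intro w hw
    have h0 : 0 < w ⬝ᵥ star w := dotProduct_self_star_pos_iff.mpr hw
    obtain ⟨hre, him⟩ := Complex.pos_iff.mp h0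
    set c : ℝ := (w ⬝ᵥ star w).re with hc
    have hcc : w ⬝ᵥ star w = (c : ℂ) := Complex.ext (by simp [hc]) (by simp [← him])
    have hcC : (c : ℂ) ≠ 0 := by exact_mod_cast hre.ne'
    refine ⟨c, c⁻¹ • vecMulVec w (star w), hre.le, ⟨⟨?_, ?_⟩, ?_⟩, ?_⟩
    · exact (posSemidef_vecMulVec_self_star w).smul (inv_nonneg.mpr hre.le)
    · rw [trace_smul, trace_vecMulVec, hcc]
      simp [hcC]
    · intro X
      simp only [smul_mul_assoc, mul_smul_comm, trace_smul]
      rw [vecMulVec_mul, vecMulVec_mul_vecMulVec, trace_vecMulVec, dotProduct_comm w]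
      ext i j
      simp [vecMulVec_apply]
      ring
    · rw [smul_inv_smul₀ hre.ne']
  by_cases hv : v = 0
  · obtain ⟨c, P, -, hP, -⟩ := key (fun _ => 1)
      (fun h => one_ne_zero (congrFun h ⟨0, hd⟩))
    exact ⟨0, P, le_rfl, hP, by simp [hv]⟩
  · exact key v hv

lemma Matrix.PosSemidef.exists_eq_sum_smul_isPure (hd : 1 ≤ d) {M : Matrix (Fin d) (Fin d) ℂ}
    (hM : M.PosSemidef) :
    ∃ (k : ℕ) (c : Fin k → ℝ) (P : Fin k → Matrix (Fin d) (Fin d) ℂ),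
      (∀ a, 0 ≤ c a) ∧ (∀ a, IsPure (P a)) ∧ M = ∑ a, c a • P a := by
  obtain ⟨k, v, rfl⟩ := posSemidef_iff_eq_sum_vecMulVec.mp hM
  choose c P hc hP h using fun a => exists_smul_isPure hd (v a)
  exact ⟨k, c, P, hc, hP, Finset.sum_congr rfl fun a _ => h a⟩

/-- Every POVM is a coarse-graining of one with rank-one effects. -/
lemma exists_pure_refinement (hd : 1 ≤ d) {n : ℕ} {M : Fin n → Matrix (Fin d) (Fin d) ℂ}
    (hM : ∀ j, (M j).PosSemidef) :
    ∃ (N : ℕ) (c : Fin N → ℝ) (P : Fin N → Matrix (Fin d) (Fin d) ℂ) (col : Fin N → Fin n),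
      (∀ e, 0 ≤ c e) ∧ (∀ e, IsPure (P e)) ∧
        ∀ j, M j = ∑ e, if col e = j then c e • P e else 0 := by
  choose k c P hc hP h using fun j => (hM j).exists_eq_sum_smul_isPure hd
  let φ := Fintype.equivFin (Σ j, Fin (k j))
  refine ⟨_, fun e => c (φ.symm e).1 (φ.symm e).2, fun e => P (φ.symm e).1 (φ.symm e).2,
    fun e => (φ.symm e).1, fun e => hc _ _, fun e => hP _ _, fun j => ?_⟩
  rw [Equiv.sum_comp φ.symm fun x : Σ j, Fin (k j) => if x.1 = j then c x.1 x.2 • P x.1 x.2 else 0,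
    Fintype.sum_sigma, Finset.sum_eq_single j]
  · simpa using h j
  · intro i _ hij
    simp [hij]
  · simp

lemma IsPure.mul_self {P : Matrix (Fin d) (Fin d) ℂ} (hP : IsPure P) : P * P = P := by
  simpa [hP.1.2] using hP.2 1

lemma IsPure.born_self {P : Matrix (Fin d) (Fin d) ℂ} (hP : IsPure P) : born P P = 1 := by
  simp [born, hP.mul_self, hP.1.2]

lemma born_nonneg {X Y : Matrix (Fin d) (Fin d) ℂ} (hX : X.PosSemidef) (hY : Y.PosSemidef) :
    0 ≤ born X Y := by
  obtain ⟨k, v, rfl⟩ := posSemidef_iff_eq_sum_vecMulVec.mp hY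
  rw [born_sum_right]
  refine Finset.sum_nonneg fun i _ => ?_
  rw [born, mul_vecMulVec, trace_vecMulVec, dotProduct_comm]
  exact hX.re_dotProduct_nonneg (v i)

/-- Nonnegativity and definiteness of the squared Hilbert–Schmidt distance `‖X - Y‖²`. -/
lemma two_mul_born_le_and_eq {X Y : Matrix (Fin d) (Fin d) ℂ} (hX : X.IsHermitian)
    (hY : Y.IsHermitian) : 2 * born X Y ≤ born X X + born Y Y ∧
      (born X X + born Y Y ≤ 2 * born X Y → X = Y) := by
  have hH : (X - Y)ᴴ = X - Y := hX.sub hY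
  have hps := posSemidef_conjTranspose_mul_self (X - Y)
  have hnn := hps.trace_nonneg
  have hexp : (((X - Y)ᴴ * (X - Y)).trace).re = born X X + born Y Y - 2 * born X Y := by
    rw [hH, sub_mul, mul_sub, mul_sub]
    simp only [trace_sub, Complex.sub_re]
    have := born_comm X Y
    simp only [born] at this ⊢
    linarith
  obtain ⟨h1, h2⟩ := Complex.nonneg_iff.mp hnn
  refine ⟨by linarith, fun h => ?_⟩
  have : ((X - Y)ᴴ * (X - Y)).trace = 0 :=
    Complex.ext (by rw [hexp] at h1 ⊢; rw [Complex.zero_re]; linarith) h2.symm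
  exact sub_eq_zero.mp (trace_conjTranspose_mul_self_eq_zero_iff.mp this)

lemma IsState.born_self_le_one (hd : 1 ≤ d) {ρ : Matrix (Fin d) (Fin d) ℂ} (hρ : IsState ρ) :
    born ρ ρ ≤ 1 := by
  obtain ⟨k, c, P, hc, hP, h⟩ := hρ.1.exists_eq_sum_smul_isPure hd
  have hle : ∀ a b, born (P a) (P b) ≤ 1 := fun a b => by
    have := (two_mul_born_le_and_eq (hP a).1.1.1 (hP b).1.1.1).1
    rw [(hP a).born_self, (hP b).born_self] at this
    linarith
  have hsum : ∑ a, c a = 1 := by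
    have := born_one_right hρ
    rw [born_comm, h, born_sum_right] at this
    simpa only [born_comm 1, born_smul_left, born_one_right (hP _).1, mul_one] using this
  calc born ρ ρ = ∑ a, c a * ∑ b, c b * born (P a) (P b) := by
        conv_lhs => rw [h]
        simp only [born_sum_right, born_smul_right]
        refine Finset.sum_congr rfl fun a _ => ?_
        rw [born_comm]
        simp only [born_sum_right, born_smul_right]
    _ ≤ ∑ a, c a * ∑ b, c b * 1 := by
        gcongr with a _ b _
        · exact hc a
        · exact hc b
        · exact hle a b
    _ = 1 := by simp [hsum]

lemma IsState.born_le_one (hd : 1 ≤ d) {ρ σ : Matrix (Fin d) (Fin d) ℂ} (hρ : IsState ρ)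
    (hσ : IsState σ) : born ρ σ ≤ 1 := by
  linarith [(two_mul_born_le_and_eq hρ.1.1 hσ.1.1).1, hρ.born_self_le_one hd, hσ.born_self_le_one hd]

lemma IsState.eq_of_born_eq_one (hd : 1 ≤ d) {ρ σ : Matrix (Fin d) (Fin d) ℂ} (hρ : IsState ρ)
    (hσ : IsState σ) (h : born ρ σ = 1) : ρ = σ :=
  (two_mul_born_le_and_eq hρ.1.1 hσ.1.1).2
    (by linarith [hρ.born_self_le_one hd, hσ.born_self_le_one hd])

lemma IsPure.mul_mul_self {P X : Matrix (Fin d) (Fin d) ℂ} (hP : IsPure P)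
    (hX : X.IsHermitian) : P * X * P = born P X • P := by
  rw [hP.2 X]
  have : (P * X).trace = (born P X : ℂ) := by
    refine (Complex.conj_eq_iff_re.mp ?_).symm
    rw [← Complex.star_def, ← trace_conjTranspose, conjTranspose_mul, hX, hP.1.1.1, trace_mul_comm]
  rw [this]
  rfl

lemma IsPure.mul_eq_zero_of_born_eq_zero {P Q : Matrix (Fin d) (Fin d) ℂ} (hP : IsPure P)
    (hQ : IsPure Q) (h : born P Q = 0) : P * Q = 0 := by
  have h1 := hQ.mul_mul_self hP.1.1.1
  rw [born_comm, h, zero_smul] at h1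
  apply conjTranspose_mul_self_eq_zero.mp
  rw [conjTranspose_mul, hP.1.1.1, hQ.1.1.1, Matrix.mul_assoc, ← Matrix.mul_assoc P, hP.mul_self,
    ← Matrix.mul_assoc, h1]

end Born

section Overlap

variable {d : ℕ}

/-- Perturbing `P` towards `Q` changes the overlap with `Q` to first order but the overlap with `P`
only to second order, unless `P` and `Q` are equal or orthogonal. -/
lemma IsPure.eq_or_mul_eq_zero (hd : 1 ≤ d) {P Q : Matrix (Fin d) (Fin d) ℂ} (hP : IsPure P)
    (hQ : IsPure Q) {c K : ℝ} (hc : 0 < c)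
    (h : ∀ σ, IsState σ → c * born σ Q - c * born P Q ≤ K * (1 - born σ P)) :
    P = Q ∨ P * Q = 0 := by
  by_contra! hne
  set a := born P Q with ha
  have ha' : born Q P = a := born_comm _ _
  have ha0 : 0 < a := lt_of_le_of_ne (born_nonneg hP.1.1 hQ.1.1)
    fun h0 => hne.2 (hP.mul_eq_zero_of_born_eq_zero hQ h0.symm)
  have ha1 : a < 1 := lt_of_le_of_ne (hP.1.born_le_one hd hQ.1)
    fun h1 => hne.1 (hP.1.eq_of_born_eq_one hd hQ.1 h1)
  have hPQP : P * Q * P = a • P := hP.mul_mul_self hQ.1.1.1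
  have hQPQ : Q * P * Q = a • Q := by rw [hQ.mul_mul_self hP.1.1.1, ha']
  have key : ∀ t : ℝ, 0 < t → c * (2 - 2 * (t * a) + t) ≤ K * t := by
    intro t ht
    set u := 1 - t * a with hu
    set Y := u ^ 2 • P + (u * t) • (Q * P + P * Q) + (t ^ 2 * a) • Q with hY
    have hYpsd : Y.PosSemidef := by
      have hG : (u • (1 : Matrix (Fin d) (Fin d) ℂ) + t • Q)ᴴ = u • 1 + t • Q := by
        rw [conjTranspose_add, conjTranspose_smul, conjTranspose_smul, hQ.1.1.1]
        simp
      have := hP.1.1.mul_mul_conjTranspose_same (u • (1 : Matrix (Fin d) (Fin d) ℂ) + t • Q)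
      convert this using 1
      rw [hG, hY, mul_smul (t ^ 2), ← hQPQ]
      simp only [add_mul, mul_add, smul_mul_assoc, mul_smul_comm, smul_add, smul_smul, one_mul,
        mul_one]
      module
    have b1 : born (Q * P) 1 = a := by simpa [born] using ha'
    have b2 : born (P * Q) 1 = a := by simp [born, ha]
    have b3 : born (Q * P) P = a := by rw [born, Matrix.mul_assoc, hP.mul_self]; exact ha'
    have b4 : born (P * Q) P = a := by rw [born, hPQP]; simp [hP.1.2]
    have b5 : born (Q * P) Q = a := by rw [born, hQPQ]; simp [hQ.1.2]
    have b6 : born (P * Q) Q = a := by rw [born, Matrix.mul_assoc, hQ.mul_self]; exact ha.symm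
    have hY1 : born Y 1 = u ^ 2 + 2 * u * t * a + t ^ 2 * a := by
      simp only [hY, born_add_left, born_smul_left, b1, b2, born_one_right hP.1,
        born_one_right hQ.1]
      ring
    have hYP : born Y P = u ^ 2 + 2 * u * t * a + t ^ 2 * a ^ 2 := by
      simp only [hY, born_add_left, born_smul_left, b3, b4, hP.born_self, ha']
      ring
    have hYQ : born Y Q = a * (u + t) ^ 2 := by
      simp only [hY, born_add_left, born_smul_left, b5, b6, hQ.born_self, ← ha]
      ring
    have hpos : 0 < born Y 1 := by
      have : born Y 1 = 1 + t ^ 2 * (a * (1 - a)) := by rw [hY1, hu]; ring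
      rw [this]
      have := mul_pos ha0 (sub_pos.mpr ha1)
      positivity
    have htr : Y.trace = (born Y 1 : ℂ) := by
      obtain ⟨-, him⟩ := Complex.nonneg_iff.mp hYpsd.trace_nonneg
      exact Complex.ext (by simp [born]) (by simp [← him])
    have hst : IsState ((born Y 1)⁻¹ • Y) := by
      refine ⟨hYpsd.smul (inv_nonneg.mpr hpos.le), ?_⟩
      rw [trace_smul, htr, Complex.real_smul, ← Complex.ofReal_mul, inv_mul_cancel₀ hpos.ne',
        Complex.ofReal_one]
    have h1 := h _ hst
    rw [born_smul_left, born_smul_left] at h1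
    have h2 : c * born Y Q - c * a * born Y 1 ≤ K * (born Y 1 - born Y P) := by
      have := mul_le_mul_of_nonneg_left h1 hpos.le
      have e1 : born Y 1 * (c * ((born Y 1)⁻¹ * born Y Q) - c * a)
          = c * born Y Q - c * a * born Y 1 := by field_simp
      have e2 : born Y 1 * (K * (1 - (born Y 1)⁻¹ * born Y P))
          = K * (born Y 1 - born Y P) := by field_simp
      rwa [e1, e2] at this
    rw [hY1, hYP, hYQ] at h2
    have hpos' : 0 < t * (a * (1 - a)) := mul_pos ht (mul_pos ha0 (sub_pos.mpr ha1))
    refine le_of_mul_le_mul_left ?_ hpos'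
    rw [hu] at h2
    linarith
  set t := min (1 / 2) (c / (2 * (|K| + 1))) with ht
  have hK : 0 < 2 * (|K| + 1) := by positivity
  have ht0 : 0 < t := lt_min (by norm_num) (div_pos hc hK)
  have ht1 : t ≤ 1 / 2 := min_le_left _ _
  have ht2 : t * (2 * (|K| + 1)) ≤ c := (le_div_iff₀ hK).mp (min_le_right _ _)
  have h1 := key t ht0
  have h2 : K * t ≤ |K| * t := mul_le_mul_of_nonneg_right (le_abs_self K) ht0.le
  have h3 : t * a ≤ 1 / 2 := by nlinarith
  nlinarith [mul_nonneg hc.le (sub_nonneg.mpr h3), mul_pos hc ht0]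

/-- If the points `c e * born σ (P e)` all lie in the polytope spanned by the statistics of finitely
many states under a post-processing of the same measurement, then the effects commute. -/
lemma eq_or_mul_eq_zero_of_polytope (hd : 1 ≤ d) {ι κ : Type*} [Fintype ι] [Fintype κ]
    {ρ : ι → Matrix (Fin d) (Fin d) ℂ} (hρ : ∀ i, IsState (ρ i))
    {c : κ → ℝ} {P : κ → Matrix (Fin d) (Fin d) ℂ} (hc : ∀ e, 0 ≤ c e) (hP : ∀ e, IsPure (P e))
    {W : κ → κ → ℝ} (hW : ∀ f e, 0 ≤ W f e) (hW1 : ∀ f, ∑ e, W f e = 1)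
    (H : ∀ σ, IsState σ → ∃ l ∈ stdSimplex ℝ ι,
      ∀ e, c e * born σ (P e) = ∑ i, l i * ∑ f, W f e * (c f * born (ρ i) (P f)))
    {e f : κ} (he : 0 < c e) (hf : 0 < c f) : P e = P f ∨ P e * P f = 0 := by
  set q : ι → κ → ℝ := fun i e => ∑ f, W f e * (c f * born (ρ i) (P f)) with hq
  have hterm : ∀ i e f, W f e * (c f * born (ρ i) (P f)) ≤ W f e * c f := fun i e f =>
    mul_le_mul_of_nonneg_left
      (mul_le_of_le_one_right (hc f) ((hρ i).born_le_one hd (hP f).1)) (hW f e)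
  have hqle : ∀ i e, q i e ≤ ∑ f, W f e * c f := fun i e =>
    Finset.sum_le_sum fun f _ => hterm i e f
  have havg : ∀ l ∈ stdSimplex ℝ ι, ∀ C : ℝ, ∑ i, l i * C = C := fun l hl C => by
    rw [← Finset.sum_mul, hl.2, one_mul]
  have hcle : ∀ e, c e ≤ ∑ f, W f e * c f := fun e => by
    obtain ⟨l, hl, h⟩ := H (P e) (hP e).1
    have h := h e
    rw [(hP e).born_self, mul_one] at h
    rw [h]
    exact (Finset.sum_le_sum fun i _ => mul_le_mul_of_nonneg_left (hqle i e) (hl.1 i)).trans_eq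
      (havg l hl _)
  have hceq : ∀ e, ∑ f, W f e * c f = c e := by
    have hsum : ∑ e, c e = ∑ e, ∑ f, W f e * c f := by
      rw [Finset.sum_comm]
      simp [← Finset.sum_mul, hW1]
    exact fun e => ((Finset.sum_eq_sum_iff_of_le fun e _ => hcle e).mp hsum e
      (Finset.mem_univ e)).symm
  have hqc : ∀ i, q i e ≤ c e := fun i => (hqle i e).trans_eq (hceq e)
  obtain ⟨g, hg⟩ : ∃ g, 0 < W g e * c g := by
    by_contra! hno
    exact absurd (hceq e ▸ Finset.sum_nonpos fun g _ => hno g) (not_le.mpr he)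
  have huniq : ∀ i, q i e = c e → ρ i = P g := fun i hi => by
    have h1 : q i e = ∑ f, W f e * c f := hi.trans (hceq e).symm
    have h2 := (Finset.sum_eq_sum_iff_of_le fun f _ => hterm i e f).mp h1 g (Finset.mem_univ g)
    rw [← mul_assoc] at h2
    exact (hρ i).eq_of_born_eq_one hd (hP g).1 (mul_left_cancel₀ hg.ne' (h2.trans (mul_one _).symm))
  obtain ⟨l₀, hl₀, h₀⟩ := H (P e) (hP e).1
  set r := c f * born (P e) (P f) with hr
  have hsupp : ∀ i, l₀ i ≠ 0 → q i e = c e := by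
    have h := h₀ e
    rw [(hP e).born_self, mul_one] at h
    have h' : ∑ i, l₀ i * q i e = ∑ i, l₀ i * c e := by rw [havg l₀ hl₀, h]
    intro i hi
    exact mul_left_cancel₀ hi ((Finset.sum_eq_sum_iff_of_le fun i _ =>
      mul_le_mul_of_nonneg_left (hqc i) (hl₀.1 i)).mp h' i (Finset.mem_univ i))
  have hrow : ∀ i, q i e = c e → q i f = r := fun i hi => by
    rw [hr, h₀ f, ← havg l₀ hl₀ (q i f)]
    refine Finset.sum_congr rfl fun j _ => ?_
    by_cases hj : l₀ j = 0
    · simp [hj]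
    · simp only [hq, huniq i hi, huniq j (hsupp j hj)]
  set K := ∑ i, |q i f - r| / (c e - q i e) with hK
  have hdist : ∀ i, q i f - r ≤ K * (c e - q i e) := fun i => by
    by_cases hi : q i e = c e
    · simp [hrow i hi, hi]
    · have hlt : 0 < c e - q i e := sub_pos.mpr (lt_of_le_of_ne (hqc i) hi)
      refine (le_abs_self _).trans ((div_le_iff₀ hlt).mp ?_)
      exact Finset.single_le_sum (f := fun i => |q i f - r| / (c e - q i e))
        (fun j _ => div_nonneg (abs_nonneg _) (sub_nonneg.mpr (hqc j))) (Finset.mem_univ i)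
  refine (hP e).eq_or_mul_eq_zero hd (hP f) (K := K * c e) hf fun σ hσ => ?_
  obtain ⟨l, hl, h⟩ := H σ hσ
  calc c f * born σ (P f) - r = ∑ i, l i * (q i f - r) := by
        simp only [mul_sub, Finset.sum_sub_distrib, havg l hl, h f, hq]
    _ ≤ ∑ i, l i * (K * (c e - q i e)) :=
        Finset.sum_le_sum fun i _ => mul_le_mul_of_nonneg_left (hdist i) (hl.1 i)
    _ = K * (c e - ∑ i, l i * q i e) := by
        rw [← havg l hl (c e), ← Finset.sum_sub_distrib, Finset.mul_sum]
        refine Finset.sum_congr rfl fun i _ => ?_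
        rw [havg l hl]
        ring
    _ = K * c e * (1 - born σ (P e)) := by
        rw [← h e]
        ring

end Overlap

/-- By compactness, a single post-processing `R` works for all points once it can be found for every
finite family of points. -/
lemma exists_rowStochastic_of_finite_families {m n N : ℕ} (A : Matrix (Fin m) (Fin n) ℝ)
    {S : Type*} (b : S → Fin N → ℝ)
    (h : ∀ (k : ℕ) (x : Fin k → S), ∃ R : Matrix (Fin n) (Fin N) ℝ, RowStochastic R ∧
      ∀ a, ∃ l ∈ stdSimplex ℝ (Fin m), l ᵥ* (A * R) = b (x a)) :
    ∃ R : Matrix (Fin n) (Fin N) ℝ, RowStochastic R ∧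
      ∀ s, ∃ l ∈ stdSimplex ℝ (Fin m), l ᵥ* (A * R) = b s := by
  let C : Set (Matrix (Fin n) (Fin N) ℝ) := Set.pi Set.univ fun _ => stdSimplex ℝ (Fin N)
  have hC : IsCompact C := isCompact_univ_pi fun _ => isCompact_stdSimplex ℝ _
  let T : S → Set (Matrix (Fin n) (Fin N) ℝ) := fun s =>
    Prod.snd '' {p : stdSimplex ℝ (Fin m) × Matrix (Fin n) (Fin N) ℝ |
      (p.1 : Fin m → ℝ) ᵥ* (A * p.2) = b s}
  have hT : ∀ s, IsClosed (T s) := fun s => by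
    refine isClosedMap_snd_of_compactSpace _ (isClosed_eq ?_ continuous_const)
    fun_prop
  obtain ⟨R, hR, hRT⟩ := hC.inter_iInter_nonempty T hT fun u => by
    obtain ⟨R, hR, hl⟩ := h u.card fun a => (u.equivFin.symm a : S)
    refine ⟨R, fun i _ => ⟨hR.1 i, hR.2 i⟩, Set.mem_iInter₂.mpr fun s hs => ?_⟩
    obtain ⟨l, hl, hls⟩ := hl (u.equivFin ⟨s, hs⟩)
    exact ⟨(⟨l, hl⟩, R), hls.trans (by simp), rfl⟩
  refine ⟨R, ⟨fun i => (hR i trivial).1, fun i => (hR i trivial).2⟩, fun s => ?_⟩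
  obtain ⟨⟨l, R'⟩, hl, rfl⟩ := Set.mem_iInter.mp hRT s
  exact ⟨l, l.2, hl⟩

section Maximal

variable {d m n N : ℕ}

lemma sum_smul_eq_one {M : Fin n → Matrix (Fin d) (Fin d) ℂ} (hM1 : ∑ j, M j = 1)
    {c : Fin N → ℝ} {P : Fin N → Matrix (Fin d) (Fin d) ℂ} {col : Fin N → Fin n}
    (hMP : ∀ j, M j = ∑ e, if col e = j then c e • P e else 0) : ∑ e, c e • P e = 1 := by
  rw [← hM1, Finset.sum_congr rfl fun j _ => hMP j, Finset.sum_comm]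
  simp

/-- For a maximal `A`, finitely many additional states do not lead outside the polytope spanned by
the rows of `A`, up to post-processing. -/
lemma exists_rowStochastic_of_maximal {A : Matrix (Fin m) (Fin n) ℝ}
    (hmax : ∀ (m' n' : ℕ) (B : Matrix (Fin m') (Fin n') ℝ),
      RowStochastic B → QuantumImpl d m' n' B → UWMaj A B → UWMaj B A)
    {ρ : Fin m → Matrix (Fin d) (Fin d) ℂ} {M : Fin n → Matrix (Fin d) (Fin d) ℂ}
    (hρ : ∀ i, IsState (ρ i)) (hM1 : ∑ j, M j = 1) (hA : ∀ i j, A i j = born (ρ i) (M j))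
    {c : Fin N → ℝ} {P : Fin N → Matrix (Fin d) (Fin d) ℂ} {col : Fin N → Fin n}
    (hc : ∀ e, 0 ≤ c e) (hP : ∀ e, IsPure (P e))
    (hMP : ∀ j, M j = ∑ e, if col e = j then c e • P e else 0)
    {k : ℕ} {x : Fin k → Matrix (Fin d) (Fin d) ℂ} (hx : ∀ a, IsState (x a)) :
    ∃ R : Matrix (Fin n) (Fin N) ℝ, RowStochastic R ∧ ∀ a, ∃ l ∈ stdSimplex ℝ (Fin m),
      l ᵥ* (A * R) = fun e => c e * born (x a) (P e) := by
  have hsum := sum_smul_eq_one hM1 hMP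
  have hcP : ∀ e, (c e • P e).PosSemidef := fun e => (hP e).1.1.smul (hc e)
  let σ : Fin (m + k) → Matrix (Fin d) (Fin d) ℂ := Fin.addCases ρ x
  have hσ : ∀ i, IsState (σ i) := fun i => by
    refine Fin.addCases (fun i => ?_) (fun i => ?_) i
    · simpa [σ] using hρ i
    · simpa [σ] using hx i
  let B : Matrix (Fin (m + k)) (Fin N) ℝ := fun i e => born (σ i) (c e • P e)
  have hB : RowStochastic B := ⟨fun i e => born_nonneg (hσ i).1 (hcP e), fun i => by
    rw [← born_sum_right, hsum, born_one_right (hσ i)]⟩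
  have hBQ : QuantumImpl d (m + k) N B := ⟨σ, fun e => c e • P e, hσ, hcP, hsum, fun _ _ => rfl⟩
  have hAB : UWMaj A B := by
    refine ⟨.of fun i i' => if i' = Fin.castAdd k i then 1 else 0,
      .of fun e j => if col e = j then 1 else 0,
      ⟨fun i i' => by rw [of_apply]; split_ifs <;> simp, fun i => by simp⟩,
      ⟨fun e j => by rw [of_apply]; split_ifs <;> simp, fun e => by simp⟩, ?_⟩
    ext i j
    rw [hA, hMP, born_sum_right, mul_apply]
    refine Finset.sum_congr rfl fun e _ => ?_
    rw [mul_apply]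
    by_cases h : col e = j <;> simp [h, B, σ, born]
  obtain ⟨L, R, hL, hR, hLR⟩ := hmax _ _ B hB hBQ hAB
  refine ⟨R, hR, fun a => ⟨L (Fin.natAdd m a), ⟨hL.1 _, hL.2 _⟩, ?_⟩⟩
  funext e
  have := congrFun (congrFun hLR (Fin.natAdd m a)) e
  rw [Matrix.mul_assoc, mul_apply_eq_vecMul] at this
  simpa [B, σ, born_smul_right] using this

/-- A matrix implemented with commuting rank-one effects is ultraweakly majorized by `I_d`. -/
lemma uwMaj_one_of_commute {A : Matrix (Fin m) (Fin n) ℝ}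
    {ρ : Fin m → Matrix (Fin d) (Fin d) ℂ} {M : Fin n → Matrix (Fin d) (Fin d) ℂ}
    (hρ : ∀ i, IsState (ρ i)) (hM1 : ∑ j, M j = 1) (hA : ∀ i j, A i j = born (ρ i) (M j))
    {c : Fin N → ℝ} {P : Fin N → Matrix (Fin d) (Fin d) ℂ} {col : Fin N → Fin n}
    (hc : ∀ e, 0 ≤ c e) (hP : ∀ e, IsPure (P e))
    (hMP : ∀ j, M j = ∑ e, if col e = j then c e • P e else 0)
    (hcomm : ∀ e f, 0 < c e → 0 < c f → P e = P f ∨ P e * P f = 0) :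
    UWMaj A (1 : Matrix (Fin d) (Fin d) ℝ) := by
  classical
  have hsum := sum_smul_eq_one hM1 hMP
  let s : Finset (Matrix (Fin d) (Fin d) ℂ) := (Finset.univ.filter fun e => 0 < c e).image P
  have hs : ∀ p ∈ s, ∃ e, 0 < c e ∧ P e = p := fun p hp => by simpa [s] using hp
  have hpure : ∀ p ∈ s, IsPure p := fun p hp => by
    obtain ⟨e, -, rfl⟩ := hs p hp
    exact hP e
  have horth : ∀ p ∈ s, ∀ q ∈ s, p ≠ q → p * q = 0 := fun p hp q hq hpq => by
    obtain ⟨e, he, rfl⟩ := hs p hp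
    obtain ⟨f, hf, rfl⟩ := hs q hq
    exact (hcomm e f he hf).resolve_left hpq
  have hgroup : ∀ e, c e • P e = ∑ p ∈ s, (if P e = p then c e else 0) • p := fun e => by
    rcases (hc e).eq_or_lt with h | h
    · simp [← h]
    · have : P e ∈ s := Finset.mem_image_of_mem P (by simpa using h)
      simp [ite_smul, this]
  let S : Matrix (Fin d) (Fin d) ℂ → Fin n → ℝ := fun p j =>
    ∑ e, if col e = j ∧ P e = p then c e else 0
  have hMS : ∀ j, M j = ∑ p ∈ s, S p j • p := fun j => by
    rw [hMP]
    simp only [S, Finset.sum_smul]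
    rw [Finset.sum_comm]
    refine Finset.sum_congr rfl fun e _ => ?_
    by_cases h : col e = j
    · simpa [h] using hgroup e
    · simp [h]
  have hone : (1 : Matrix (Fin d) (Fin d) ℂ) = ∑ p ∈ s, (∑ j, S p j) • p := by
    rw [← hM1, Finset.sum_congr rfl fun j _ => hMS j, Finset.sum_comm]
    simp only [Finset.sum_smul]
  have hS1 : ∀ p ∈ s, ∑ j, S p j = 1 := fun p hp => by
    have h1 := born_one_right (hpure p hp).1
    rw [hone, born_sum_right, Finset.sum_eq_single_of_mem p hp] at h1
    · rwa [born_smul_right, (hpure p hp).born_self, mul_one] at h1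
    · intro q hq hqp
      rw [born_smul_right, born, horth p hp q hq hqp.symm]
      simp
  have hone' : (1 : Matrix (Fin d) (Fin d) ℂ) = ∑ p ∈ s, p := by
    rw [hone]
    exact Finset.sum_congr rfl fun p hp => by rw [hS1 p hp, one_smul]
  have hcard : s.card = d := by
    have := congrArg trace hone'
    rw [trace_one, trace_sum, Finset.sum_congr rfl fun p hp => (hpure p hp).1.2] at this
    have h : (d : ℂ) = s.card := by simpa using this
    exact_mod_cast h.symm
  let φ := s.equivFinOfCardEq hcard
  have hφ : ∀ g : Matrix (Fin d) (Fin d) ℂ → ℝ, ∑ k, g (φ.symm k) = ∑ p ∈ s, g p := fun g => by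
    rw [Equiv.sum_comp φ.symm fun p : s => g p, Finset.sum_coe_sort s g]
  refine ⟨.of fun i k => born (ρ i) (φ.symm k), .of fun k j => S (φ.symm k) j,
    ⟨fun i k => ?_, fun i => ?_⟩, ⟨fun k j => ?_, fun k => hS1 _ (φ.symm k).2⟩, ?_⟩
  · exact born_nonneg (hρ i).1 (hpure _ (φ.symm k).2).1.1
  · simp only [of_apply]
    rw [hφ fun p => born (ρ i) p, ← born_sum_right, ← hone', born_one_right (hρ i)]
  · rw [of_apply]
    exact Finset.sum_nonneg fun e _ => by split_ifs <;> simp [hc]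
  · ext i j
    simp only [Matrix.mul_one, mul_apply, of_apply]
    rw [hφ fun p => born (ρ i) p * S p j, hA, hMS, born_sum_right]
    exact Finset.sum_congr rfl fun p _ => by rw [born_smul_right, mul_comm]

/-- The identity matrix is implemented by the computational basis. -/
lemma quantumImpl_one : QuantumImpl d d d (1 : Matrix (Fin d) (Fin d) ℝ) := by
  have hpsd : ∀ i : Fin d, (Matrix.single i i (1 : ℂ)).PosSemidef := fun i => by
    rw [← diagonal_single]
    exact .diagonal (Pi.single_nonneg.mpr zero_le_one)
  refine ⟨fun i => Matrix.single i i 1, fun j => Matrix.single j j 1,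
    fun i => ⟨hpsd i, by simp⟩, hpsd, ?_, fun i j => ?_⟩
  · exact sum_single_one
  · by_cases h : i = j
    · subst h
      simp
    · simp [h]

lemma rowStochastic_one : RowStochastic (1 : Matrix (Fin d) (Fin d) ℝ) :=
  ⟨fun i j => by rw [Matrix.one_apply]; split_ifs <;> simp, fun i => by simp [Matrix.one_apply]⟩

end Maximal

/-- any ultraweakly maximal element among matrices with a quantum
implementation in dimension `d` is ultraweakly equivalent to `I_d`, i.e. the
class of `I_d` is the only maximal element. -/
theorem id_class_unique_maximal (d m n : ℕ) (hd : 1 ≤ d)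
    (A : Matrix (Fin m) (Fin n) ℝ) (hA : RowStochastic A)
    (hQ : QuantumImpl d m n A)
    (hmaximal : ∀ (m' n' : ℕ) (B : Matrix (Fin m') (Fin n') ℝ),
      RowStochastic B → QuantumImpl d m' n' B → UWMaj A B → UWMaj B A) :
    UWMaj A (1 : Matrix (Fin d) (Fin d) ℝ) ∧
    UWMaj (1 : Matrix (Fin d) (Fin d) ℝ) A := by
  obtain ⟨ρ, M, hρ, hM, hM1, hAρ⟩ := hQ
  have hρ : ∀ i, IsState (ρ i) := hρ
  have hAρ : ∀ i j, A i j = born (ρ i) (M j) := hAρ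
  obtain ⟨N, c, P, col, hc, hP, hMP⟩ := exists_pure_refinement hd hM
  obtain ⟨R, hR, hRσ⟩ := exists_rowStochastic_of_finite_families A
    (fun (σ : {σ : Matrix (Fin d) (Fin d) ℂ // IsState σ}) e => c e * born σ.1 (P e))
    fun k x => exists_rowStochastic_of_maximal hmaximal hρ hM1 hAρ hc hP hMP
      (x := fun a => (x a).1) fun a => (x a).2
  have hAR : ∀ i e, (A * R) i e = ∑ f, R (col f) e * (c f * born (ρ i) (P f)) := fun i e => by
    rw [mul_apply]
    simp only [hAρ, hMP, born_sum_right, Finset.sum_mul]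
    rw [Finset.sum_comm]
    refine Finset.sum_congr rfl fun f _ => ?_
    rw [Finset.sum_eq_single_of_mem (col f) (Finset.mem_univ _)]
    · simp [born_smul_right, mul_comm]
    · intro j _ hj
      simp [hj.symm, born]
  have hA1 : UWMaj A (1 : Matrix (Fin d) (Fin d) ℝ) := by
    refine uwMaj_one_of_commute hρ hM1 hAρ hc hP hMP fun e f he hf => ?_
    refine eq_or_mul_eq_zero_of_polytope hd hρ hc hP (W := fun f e => R (col f) e)
      (fun f e => hR.1 _ _) (fun f => hR.2 _) (fun σ hσ => ?_) he hf
    obtain ⟨l, hl, h⟩ := hRσ ⟨σ, hσ⟩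
    refine ⟨l, hl, fun e => ?_⟩
    simpa only [vecMul, dotProduct, hAR] using (congrFun h e).symm
  exact ⟨hA1, hmaximal d d 1 rowStochastic_one quantumImpl_one hA1⟩
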